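/- arXiv:math/0109181 — 5 statements merged into one kernel-verified Lean document; each statement's English description precedes it below -/
import Mathlib

section
/- There exists R₀ > 0 with the following property: for every R with 0 < R < R₀ such that the closed ball of radius R centered at z₀ is contained in 𝒰, there exist a smaller ball 𝒱 = B(z₀, r) with 0 < r < R and a constant c > 0 such that Re Φ_θ(ζ, z) > c for every unit vector θ ∈ 𝕊^{m−1}, every ζ ∈ M with |ζ − z₀| = R, and every z ∈ 𝒱. -/
open Metric

/-- Wirtinger derivative `∂f/∂z_i = (1/2)(∂f/∂x_i − √−1·∂f/∂y_i)`. -/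
noncomputable def wz {n : ℕ} (f : EuclideanSpace ℂ (Fin n) → ℂ) (i : Fin n)
    (z : EuclideanSpace ℂ (Fin n)) : ℂ :=
  (1 / 2 : ℂ) * (fderiv ℝ f z (EuclideanSpace.single i 1) -
    Complex.I * fderiv ℝ f z (EuclideanSpace.single i Complex.I))

/-- Wirtinger derivative `∂f/∂z̄_i = (1/2)(∂f/∂x_i + √−1·∂f/∂y_i)`. -/
noncomputable def wzbar {n : ℕ} (f : EuclideanSpace ℂ (Fin n) → ℂ) (i : Fin n)
    (z : EuclideanSpace ℂ (Fin n)) : ℂ :=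
  (1 / 2 : ℂ) * (fderiv ℝ f z (EuclideanSpace.single i 1) +
    Complex.I * fderiv ℝ f z (EuclideanSpace.single i Complex.I))

/-- `Q_i(ζ,z) = −(∂ρ/∂z_i)(z) − (1/2)·∑_j (∂²ρ/∂z_i∂z_j)(z)·(ζ_j − z_j)`. -/
noncomputable def QQ {n : ℕ} (ρ : EuclideanSpace ℂ (Fin n) → ℝ)
    (ζ z : EuclideanSpace ℂ (Fin n)) (i : Fin n) : ℂ :=
  - wz (fun v => ((ρ v : ℝ) : ℂ)) i z -
    (1 / 2 : ℂ) * ∑ j, wz (fun w => wz (fun v => ((ρ v : ℝ) : ℂ)) j w) i z * (ζ j - z j)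

/-- `F(ζ,z) = ∑_i Q_i(ζ,z)·(ζ_i − z_i)`. -/
noncomputable def FF {n : ℕ} (ρ : EuclideanSpace ℂ (Fin n) → ℝ)
    (ζ z : EuclideanSpace ℂ (Fin n)) : ℂ :=
  ∑ i, QQ ρ ζ z i * (ζ i - z i)

/-- The Levi form `ℒ_zρ(w) = ∑_{i,j} (∂²ρ/∂z_i∂z̄_j)(z)·w_i·w̄_j` (as a complex number;
it is real for `ρ` of class `C²`). -/
noncomputable def levi {n : ℕ} (ρ : EuclideanSpace ℂ (Fin n) → ℝ)
    (z w : EuclideanSpace ℂ (Fin n)) : ℂ :=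
  ∑ i, ∑ j, wz (fun u => wzbar (fun v => ((ρ v : ℝ) : ℂ)) j u) i z * w i * (starRingEnd ℂ) (w j)

/-- `𝒜(θ,z,w) = ∑_j |A_j(θ,z,w)|²` where `A_j(θ,z,w) = ∑_i a_{ji}(θ,z)·w_i`. -/
noncomputable def AA {n m N' : ℕ}
    (a : Fin N' → EuclideanSpace ℝ (Fin m) → EuclideanSpace ℂ (Fin n) → EuclideanSpace ℂ (Fin n))
    (θ : EuclideanSpace ℝ (Fin m)) (z w : EuclideanSpace ℂ (Fin n)) : ℝ :=
  ∑ j, ‖∑ i, a j θ z i * w i‖ ^ 2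

/-- `Φ_θ(ζ,z) = ∑_k θ_k·F^{(k)}(ζ,z) + 𝒜(θ,z,ζ−z)`. -/
noncomputable def PhiTheta {n m N' : ℕ} (ρ : Fin m → EuclideanSpace ℂ (Fin n) → ℝ)
    (a : Fin N' → EuclideanSpace ℝ (Fin m) → EuclideanSpace ℂ (Fin n) → EuclideanSpace ℂ (Fin n))
    (θ : EuclideanSpace ℝ (Fin m)) (ζ z : EuclideanSpace ℂ (Fin n)) : ℂ :=
  (∑ k, ((θ k : ℝ) : ℂ) * FF (ρ k) ζ z) + ((AA a θ z (ζ - z) : ℝ) : ℂ)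

/-- `θ(ζ) = (−ρ₁(ζ)/ρ(ζ), …, −ρ_m(ζ)/ρ(ζ))` where `ρ(ζ) = (∑ ρ_k(ζ)²)^{1/2}`. -/
noncomputable def thetaOf {n m : ℕ} (ρ : Fin m → EuclideanSpace ℂ (Fin n) → ℝ)
    (ζ : EuclideanSpace ℂ (Fin n)) : EuclideanSpace ℝ (Fin m) :=
  (WithLp.equiv 2 (∀ _ : Fin m, ℝ)).symm
    (fun k => -(ρ k ζ) / Real.sqrt (∑ k', ρ k' ζ ^ 2))

theorem norm_taylor_two_unitInterval_le {F : Type*} [NormedAddCommGroup F] [NormedSpace ℝ F]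
    {φ φ' φ'' : ℝ → F} {C : ℝ} (h0 : ∀ t ∈ Set.Icc (0 : ℝ) 1, HasDerivAt φ (φ' t) t)
    (h1 : ∀ t ∈ Set.Icc (0 : ℝ) 1, HasDerivAt φ' (φ'' t) t)
    (hC : ∀ t ∈ Set.Icc (0 : ℝ) 1, ‖φ'' t - φ'' 0‖ ≤ C) :
    ‖φ 1 - φ 0 - φ' 0 - (1 / 2 : ℝ) • φ'' 0‖ ≤ C := by
  have hC0 : 0 ≤ C := (norm_nonneg _).trans (hC 0 (by simp))
  have hd1 : ∀ t ∈ Set.Icc (0 : ℝ) 1, HasDerivWithinAt (fun s => φ' s - s • φ'' 0)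
      (φ'' t - φ'' 0) (Set.Icc 0 1) t := fun t ht => by
    simpa using ((h1 t ht).fun_sub ((hasDerivAt_id t).smul_const (φ'' 0))).hasDerivWithinAt
  have hb1 : ∀ t ∈ Set.Icc (0 : ℝ) 1, ‖φ' t - t • φ'' 0 - φ' 0‖ ≤ C := fun t ht => by
    have h := norm_image_sub_le_of_norm_deriv_le_segment' hd1
      (fun s hs => hC s (Set.Ico_subset_Icc_self hs)) t ht
    simp only [zero_smul, sub_zero] at h
    exact h.trans (mul_le_of_le_one_right hC0 ht.2)
  have hd0 : ∀ t ∈ Set.Icc (0 : ℝ) 1, HasDerivWithinAt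
      (fun s => φ s - s • φ' 0 - (s ^ 2 / 2) • φ'' 0)
      (φ' t - t • φ'' 0 - φ' 0) (Set.Icc 0 1) t := fun t ht => by
    have h2 : HasDerivAt (fun s : ℝ => s ^ 2 / 2) t t := by
      simpa using ((hasDerivAt_id t).pow 2).div_const 2
    have h := ((h0 t ht).sub ((hasDerivAt_id t).smul_const (φ' 0))).sub (h2.smul_const (φ'' 0))
    refine (h.congr_deriv ?_).hasDerivWithinAt
    simp only [one_smul]
    abel
  have h := norm_image_sub_le_of_norm_deriv_le_segment_01' hd0
    (fun s hs => hb1 s (Set.Ico_subset_Icc_self hs))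
  refine le_trans (le_of_eq ?_) h
  congr 1
  norm_num
  abel

theorem exists_ball_norm_taylor_two_le {E F : Type*} [NormedAddCommGroup E]
    [NormedSpace ℝ E] [NormedAddCommGroup F] [NormedSpace ℝ F] {f : E → F} {x₀ : E}
    (hf : ContDiffAt ℝ 2 f x₀) {ε : ℝ} (hε : 0 < ε) :
    ∃ δ > 0, ∀ z ∈ ball x₀ δ, ContDiffAt ℝ 2 f z ∧ ∀ x ∈ ball x₀ δ,
      ‖f x - f z - fderiv ℝ f z (x - z) -
        (1 / 2 : ℝ) • fderiv ℝ (fun u => fderiv ℝ f u (x - z)) z (x - z)‖ ≤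
          ε * ‖x - z‖ ^ 2 := by
  have hD : ContDiffAt ℝ 1 (fderiv ℝ f) x₀ := hf.fderiv_right (by norm_num)
  have hDD : ContinuousAt (fderiv ℝ (fderiv ℝ f)) x₀ :=
    (hD.fderiv_right (m := 0) (by norm_num)).continuousAt
  have hnear : ∀ᶠ u in nhds x₀,
      dist (fderiv ℝ (fderiv ℝ f) u) (fderiv ℝ (fderiv ℝ f) x₀) < ε / 2 :=
    Metric.tendsto_nhds.1 hDD.tendsto _ (half_pos hε)
  have hev := (hf.eventually (by simp)).and hnear
  obtain ⟨δ, hδ, hball⟩ := Metric.eventually_nhds_iff_ball.1 hev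
  refine ⟨δ, hδ, fun z hz => ⟨(hball z hz).1, fun x hx => ?_⟩⟩
  set w := x - z with hw
  have hmem : ∀ t ∈ Set.Icc (0 : ℝ) 1, z + t • w ∈ ball x₀ δ := fun t ht =>
    (convex_ball x₀ δ).add_smul_sub_mem hz hx ht
  have hdiff : ∀ u ∈ ball x₀ δ, DifferentiableAt ℝ f u := fun u hu =>
    (hball u hu).1.differentiableAt (by norm_num)
  have hdiff' : ∀ u ∈ ball x₀ δ, DifferentiableAt ℝ (fderiv ℝ f) u := fun u hu =>
    ((hball u hu).1.fderiv_right (m := 1) (by norm_num)).differentiableAt (by norm_num)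
  have hline : ∀ t : ℝ, HasDerivAt (fun s : ℝ => z + s • w) w t := fun t => by
    simpa using ((hasDerivAt_id t).smul_const w).const_add z
  set D2 := fderiv ℝ (fderiv ℝ f)
  have hsecond : fderiv ℝ (fun u => fderiv ℝ f u w) z w = D2 z w w := by
    rw [fderiv_clm_apply (hdiff' z hz) (by fun_prop)]
    simp [D2]
  rw [hsecond]
  have h0 : ∀ t ∈ Set.Icc (0 : ℝ) 1, HasDerivAt (fun s : ℝ => f (z + s • w))
      (fderiv ℝ f (z + t • w) w) t := fun t ht =>
    (hdiff _ (hmem t ht)).hasFDerivAt.comp_hasDerivAt t (hline t)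
  have h1 : ∀ t ∈ Set.Icc (0 : ℝ) 1, HasDerivAt (fun s : ℝ => fderiv ℝ f (z + s • w) w)
      (D2 (z + t • w) w w) t := fun t ht =>
    (ContinuousLinearMap.apply ℝ F w).hasFDerivAt.comp_hasDerivAt t
      ((hdiff' _ (hmem t ht)).hasFDerivAt.comp_hasDerivAt t (hline t))
  have hb1 : ∀ t ∈ Set.Icc (0 : ℝ) 1, ‖D2 (z + t • w) w w - D2 z w w‖ ≤ ε * ‖w‖ ^ 2 :=
    fun t ht => by
    have hd : ‖D2 (z + t • w) - D2 z‖ ≤ ε := by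
      refine (dist_eq_norm (D2 (z + t • w)) (D2 z)).symm.trans_le ?_
      have h3 := (hball _ (hmem t ht)).2
      have h4 := (hball z hz).2
      linarith [dist_triangle_right (D2 (z + t • w)) (D2 z) (D2 x₀)]
    calc ‖D2 (z + t • w) w w - D2 z w w‖ = ‖(D2 (z + t • w) - D2 z) w w‖ := by simp
      _ ≤ ‖D2 (z + t • w) - D2 z‖ * ‖w‖ * ‖w‖ := ContinuousLinearMap.le_opNorm₂ _ _ _
      _ ≤ ε * ‖w‖ * ‖w‖ := by gcongr
      _ = ε * ‖w‖ ^ 2 := by ring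
  have h := norm_taylor_two_unitInterval_le h0 h1 (C := ε * ‖w‖ ^ 2) (by simpa using hb1)
  simpa [hw] using h

theorem Complex.im_fderiv_apply_eq_zero {E : Type*} [NormedAddCommGroup E] [NormedSpace ℝ E]
    {f : E → ℂ} (hf : ∀ u, (f u).im = 0) (z v : E) : (fderiv ℝ f z v).im = 0 := by
  by_cases hd : DifferentiableAt ℝ f z
  · have h := (Complex.imCLM.hasFDerivAt (x := f z)).comp z hd.hasFDerivAt
    have h0 : (⇑Complex.imCLM ∘ f) = fun _ => 0 := funext hf
    rw [h0] at h
    have := h.unique (hasFDerivAt_const (0 : ℝ) z)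
    simpa using congrArg (fun L => L v) this
  · simp [fderiv_zero_of_not_differentiableAt hd]

section Wirtinger

variable {n : ℕ}

theorem sum_apply_single_re_im (L : EuclideanSpace ℂ (Fin n) →L[ℝ] ℂ)
    (w : EuclideanSpace ℂ (Fin n)) :
    L w = ∑ i, (((w i).re : ℂ) * L (EuclideanSpace.single i 1) +
      ((w i).im : ℂ) * L (EuclideanSpace.single i Complex.I)) := by
  have hw : w = ∑ i, ((w i).re • EuclideanSpace.single i (1 : ℂ) +
      (w i).im • EuclideanSpace.single i Complex.I) := by
    ext j
    simp [Finset.sum_apply, Pi.single_apply, Finset.sum_add_distrib]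
  conv_lhs => rw [hw]
  simp [map_sum]

theorem sum_wz_mul (f : EuclideanSpace ℂ (Fin n) → ℂ) (z w : EuclideanSpace ℂ (Fin n)) :
    ∑ i, wz f i z * w i =
      (1 / 2 : ℂ) * (fderiv ℝ f z w - Complex.I * fderiv ℝ f z (Complex.I • w)) := by
  rw [sum_apply_single_re_im _ w, sum_apply_single_re_im _ (Complex.I • w), Finset.mul_sum,
    ← Finset.sum_sub_distrib, Finset.mul_sum]
  refine Finset.sum_congr rfl fun i _ => ?_
  simp only [wz, PiLp.smul_apply, smul_eq_mul, Complex.I_mul_re, Complex.I_mul_im,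
    Complex.ofReal_neg]
  conv_lhs => rw [← Complex.re_add_im (w i)]
  linear_combination
    (-(1 / 2 : ℂ) * (w i).im * fderiv ℝ f z (EuclideanSpace.single i Complex.I)) *
      Complex.I_mul_I

theorem sum_wzbar_mul_conj (f : EuclideanSpace ℂ (Fin n) → ℂ)
    (z w : EuclideanSpace ℂ (Fin n)) :
    ∑ i, wzbar f i z * (starRingEnd ℂ) (w i) =
      (1 / 2 : ℂ) * (fderiv ℝ f z w + Complex.I * fderiv ℝ f z (Complex.I • w)) := by
  rw [sum_apply_single_re_im _ w, sum_apply_single_re_im _ (Complex.I • w), Finset.mul_sum,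
    ← Finset.sum_add_distrib, Finset.mul_sum]
  refine Finset.sum_congr rfl fun i _ => ?_
  have hc : (starRingEnd ℂ) (w i) = (w i).re - (w i).im * Complex.I := by
    apply Complex.ext <;> simp
  simp only [wzbar, PiLp.smul_apply, smul_eq_mul, Complex.I_mul_re, Complex.I_mul_im,
    Complex.ofReal_neg, hc]
  linear_combination
    (-(1 / 2 : ℂ) * (w i).im * fderiv ℝ f z (EuclideanSpace.single i Complex.I)) *
      Complex.I_mul_I

theorem sum_wz_add_sum_wzbar (f : EuclideanSpace ℂ (Fin n) → ℂ)
    (z w : EuclideanSpace ℂ (Fin n)) :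
    ∑ i, wz f i z * w i + ∑ i, wzbar f i z * (starRingEnd ℂ) (w i) = fderiv ℝ f z w := by
  rw [sum_wz_mul, sum_wzbar_mul_conj]
  ring

theorem re_sum_wz_mul {f : EuclideanSpace ℂ (Fin n) → ℂ} (hf : ∀ u, (f u).im = 0)
    (z w : EuclideanSpace ℂ (Fin n)) :
    (∑ i, wz f i z * w i).re = (1 / 2) * (fderiv ℝ f z w).re := by
  rw [sum_wz_mul]
  simp [Complex.mul_re, Complex.im_fderiv_apply_eq_zero hf]

theorem wz_sum_mul {ι : Type*} (s : Finset ι) {g : ι → EuclideanSpace ℂ (Fin n) → ℂ}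
    {z : EuclideanSpace ℂ (Fin n)} (hg : ∀ j ∈ s, DifferentiableAt ℝ (g j) z) (c : ι → ℂ)
    (i : Fin n) :
    wz (fun u => ∑ j ∈ s, g j u * c j) i z = ∑ j ∈ s, wz (g j) i z * c j := by
  have h : fderiv ℝ (fun u => ∑ j ∈ s, g j u * c j) z = ∑ j ∈ s, c j • fderiv ℝ (g j) z := by
    rw [fderiv_fun_sum fun j hj => (hg j hj).mul_const (c j)]
    exact Finset.sum_congr rfl fun j hj => fderiv_mul_const (hg j hj) (c j)
  simp only [wz, h, sum_apply, smul_apply, smul_eq_mul,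
    Finset.mul_sum, ← Finset.sum_sub_distrib]
  refine Finset.sum_congr rfl fun j _ => ?_
  ring

theorem wz_add {g h : EuclideanSpace ℂ (Fin n) → ℂ} {z : EuclideanSpace ℂ (Fin n)}
    (hg : DifferentiableAt ℝ g z) (hh : DifferentiableAt ℝ h z) (i : Fin n) :
    wz (fun u => g u + h u) i z = wz g i z + wz h i z := by
  simp only [wz, fderiv_fun_add hg hh, add_apply]
  ring

/-- The holomorphic Hessian and the Levi form add up to half of the real Hessian. -/
theorem re_sum_wz_wz_add_re_levi {ρ : EuclideanSpace ℂ (Fin n) → ℝ}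
    {z : EuclideanSpace ℂ (Fin n)} (hρ : ContDiffAt ℝ 2 (fun v => (ρ v : ℂ)) z)
    (w : EuclideanSpace ℂ (Fin n)) :
    (∑ i, ∑ j, wz (fun u => wz (fun v => (ρ v : ℂ)) j u) i z * w j * w i).re +
      (levi ρ z w).re =
      (1 / 2) * (fderiv ℝ (fun u => fderiv ℝ (fun v => (ρ v : ℂ)) u w) z w).re := by
  set f : EuclideanSpace ℂ (Fin n) → ℂ := fun v => (ρ v : ℂ) with hf
  have hD : DifferentiableAt ℝ (fderiv ℝ f) z :=
    (hρ.fderiv_right (m := 1) (by norm_num)).differentiableAt (by norm_num)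
  have hDv : ∀ v, DifferentiableAt ℝ (fun u => fderiv ℝ f u v) z := fun v =>
    hD.clm_apply (differentiableAt_const v)
  have hwz : ∀ j, DifferentiableAt ℝ (fun u => wz f j u) z := fun j =>
    ((hDv _).sub ((hDv _).const_mul _)).const_mul _
  have hwzbar : ∀ j, DifferentiableAt ℝ (fun u => wzbar f j u) z := fun j =>
    ((hDv _).add ((hDv _).const_mul _)).const_mul _
  rw [← re_sum_wz_mul (fun u => Complex.im_fderiv_apply_eq_zero (f := f) (by simp [hf]) u w),
    ← Complex.add_re]
  congr 1
  simp only [levi, ← Finset.sum_add_distrib]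
  refine Finset.sum_congr rfl fun i _ => ?_
  simp only [← sum_wz_add_sum_wzbar f _ w]
  rw [wz_add (DifferentiableAt.fun_sum fun j _ => (hwz j).mul_const _)
    (DifferentiableAt.fun_sum fun j _ => (hwzbar j).mul_const _),
    wz_sum_mul _ fun j _ => hwz j, wz_sum_mul _ fun j _ => hwzbar j, ← Finset.sum_add_distrib,
    Finset.sum_mul]
  refine Finset.sum_congr rfl fun j _ => ?_
  rw [← hf]
  ring

theorem two_mul_re_FF {ρ : EuclideanSpace ℂ (Fin n) → ℝ} {ζ z : EuclideanSpace ℂ (Fin n)}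
    (hρ : ContDiffAt ℝ 2 (fun v => (ρ v : ℂ)) z) :
    2 * (FF ρ ζ z).re = (levi ρ z (ζ - z)).re - (fderiv ℝ (fun v => (ρ v : ℂ)) z (ζ - z)).re -
      (1 / 2) * (fderiv ℝ (fun u => fderiv ℝ (fun v => (ρ v : ℂ)) u (ζ - z)) z (ζ - z)).re := by
  have h1 := re_sum_wz_mul (f := fun v => (ρ v : ℂ)) (by simp) z (ζ - z)
  have h2 := re_sum_wz_wz_add_re_levi hρ (ζ - z)
  have hFF : FF ρ ζ z = -(∑ i, wz (fun v => (ρ v : ℂ)) i z * (ζ - z) i) - ((1 / 2 : ℝ) : ℂ) *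
      ∑ i, ∑ j, wz (fun u => wz (fun v => (ρ v : ℂ)) j u) i z * (ζ - z) j * (ζ - z) i := by
    rw [Finset.mul_sum, ← Finset.sum_neg_distrib, ← Finset.sum_sub_distrib]
    refine Finset.sum_congr rfl fun i _ => ?_
    rw [← Finset.sum_mul]
    simp only [QQ, PiLp.sub_apply]
    push_cast
    ring
  rw [hFF, Complex.sub_re, Complex.neg_re, Complex.re_ofReal_mul]
  linarith

end Wirtinger

/-- Local second order estimate for the real part of the Levi polynomial. -/
theorem exists_ball_abs_two_mul_re_FF_sub_le {n : ℕ} {ρ : EuclideanSpace ℂ (Fin n) → ℝ}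
    {z₀ : EuclideanSpace ℂ (Fin n)} (hρ : ContDiffAt ℝ 2 ρ z₀) {ε : ℝ} (hε : 0 < ε) :
    ∃ δ > 0, ∀ z ∈ ball z₀ δ, ∀ ζ ∈ ball z₀ δ,
      |2 * (FF ρ ζ z).re - (ρ z - ρ ζ + (levi ρ z (ζ - z)).re)| ≤ ε * ‖ζ - z‖ ^ 2 := by
  have hf : ContDiffAt ℝ 2 (fun v => (ρ v : ℂ)) z₀ :=
    Complex.ofRealCLM.contDiff.contDiffAt.comp z₀ hρ
  obtain ⟨δ, hδ, h⟩ := exists_ball_norm_taylor_two_le hf hε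
  refine ⟨δ, hδ, fun z hz ζ hζ => ?_⟩
  refine le_trans (le_of_eq ?_) ((Complex.abs_re_le_norm _).trans ((h z hz).2 ζ hζ))
  rw [two_mul_re_FF (h z hz).1]
  simp only [Complex.sub_re, Complex.ofReal_re, Complex.real_smul, Complex.re_ofReal_mul]
  congr 1
  ring

/-- Lemma 2.1: uniform positive lower bound for `Re Φ_θ(ζ,z)` with `ζ` on
the sphere of radius `R` around `z₀` (on `M`) and `z` in a small ball around `z₀`. -/
theorem versal_stmt_5 (n m q : ℕ) (hm : 1 ≤ m) (hq : 1 ≤ q) (hqm : q + m ≤ n)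
    (U : Set (EuclideanSpace ℂ (Fin n))) (hU : IsOpen U)
    (z₀ : EuclideanSpace ℂ (Fin n)) (hz₀ : z₀ ∈ U)
    (ρ : Fin m → EuclideanSpace ℂ (Fin n) → ℝ)
    (hρ : ∀ k, ContDiffOn ℝ 3 (ρ k) U)
    (hρb : ∀ k, ∃ K : ℝ, ∀ i ≤ 3, ∀ x ∈ U, ‖iteratedFDerivWithin ℝ i (ρ k) U x‖ ≤ K)
    (hz₀M : ∀ k, ρ k z₀ = 0)
    (a : Fin (n - q - m) →
      EuclideanSpace ℝ (Fin m) → EuclideanSpace ℂ (Fin n) → EuclideanSpace ℂ (Fin n))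
    (ha : ∀ j, ContinuousOn
      (fun p : EuclideanSpace ℝ (Fin m) × EuclideanSpace ℂ (Fin n) => a j p.1 p.2)
      (sphere (0 : EuclideanSpace ℝ (Fin m)) 1 ×ˢ U))
    (hab : ∀ j, ∃ B : ℝ, ∀ θ ∈ sphere (0 : EuclideanSpace ℝ (Fin m)) 1, ∀ z ∈ U,
      ‖a j θ z‖ ≤ B)
    (c₀ : ℝ) (hc₀ : 0 < c₀)
    (hLevi : ∀ θ : EuclideanSpace ℝ (Fin m), ‖θ‖ = 1 → ∀ z ∈ U,
      ∀ w : EuclideanSpace ℂ (Fin n),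
        c₀ * ‖w‖ ^ 2 ≤ (∑ k, ((θ k : ℝ) : ℂ) * levi (ρ k) z w).re + AA a θ z w) :
    ∃ R₀ : ℝ, 0 < R₀ ∧
      ∀ R : ℝ, 0 < R → R < R₀ → closedBall z₀ R ⊆ U →
        ∃ r : ℝ, 0 < r ∧ r < R ∧ ∃ c : ℝ, 0 < c ∧
          ∀ θ : EuclideanSpace ℝ (Fin m), ‖θ‖ = 1 →
            ∀ ζ ∈ U, (∀ k, ρ k ζ = 0) → dist ζ z₀ = R →
              ∀ z ∈ ball z₀ r, c < (PhiTheta ρ a θ ζ z).re := by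
  have hN : (0 : ℝ) < m := by exact_mod_cast hm
  have hcd : ∀ k, ContDiffAt ℝ 2 (ρ k) z₀ := fun k =>
    ((hρ k).contDiffAt (hU.mem_nhds hz₀)).of_le (by norm_num)
  choose δ hδ hF using fun k =>
    exists_ball_abs_two_mul_re_FF_sub_le (hcd k) (ε := c₀ / (4 * m)) (by positivity)
  obtain ⟨R₀, hR₀, hR₀δ⟩ : ∃ R₀ > 0, ∀ k, R₀ ≤ δ k := by
    have hne : (Finset.univ : Finset (Fin m)).Nonempty := ⟨⟨0, hm⟩, Finset.mem_univ _⟩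
    exact ⟨Finset.univ.inf' hne δ, (Finset.lt_inf'_iff hne).2 fun k _ => hδ k,
      fun k => Finset.inf'_le _ (Finset.mem_univ k)⟩
  refine ⟨R₀, hR₀, fun R hR hRR₀ hRU => ?_⟩
  have hcont : ContinuousAt (fun z => ∑ k, |ρ k z|) z₀ :=
    tendsto_finsetSum _ fun k _ => (hcd k).continuousAt.abs
  have hsmall : ∀ᶠ z in nhds z₀, ∑ k, |ρ k z| < c₀ * R ^ 2 / 16 :=
    hcont.eventually_lt_const (by simp only [hz₀M, abs_zero, Finset.sum_const_zero]; positivity)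
  obtain ⟨r, hr, hball⟩ := Metric.eventually_nhds_iff_ball.1 hsmall
  refine ⟨min r (R / 2), by positivity, (min_le_right _ _).trans_lt (by linarith),
    c₀ * R ^ 2 / 32, by positivity, fun θ hθ ζ _ hζM hζ z hz => ?_⟩
  have hzr : z ∈ ball z₀ r := ball_subset_ball (min_le_left _ _) hz
  have hzR : dist z z₀ < R / 2 := ball_subset_ball (min_le_right _ _) hz
  have hzU : z ∈ U := hRU (mem_closedBall.2 (by linarith))
  have hw : R / 2 ≤ ‖ζ - z‖ := by
    rw [← dist_eq_norm]
    linarith [dist_triangle ζ z z₀]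
  have hθk : ∀ k, |θ k| ≤ 1 := fun k => by
    simpa [hθ] using PiLp.norm_apply_le θ k
  have hterm : ∀ k, θ k * (levi (ρ k) z (ζ - z)).re - |ρ k z| - c₀ / (4 * m) * ‖ζ - z‖ ^ 2 ≤
      2 * (θ k * (FF (ρ k) ζ z).re) := fun k => by
    have h1 := hF k z (mem_ball.2 (by linarith [hR₀δ k])) ζ (mem_ball.2 (by linarith [hR₀δ k]))
    rw [hζM k, sub_zero] at h1
    set X := 2 * (FF (ρ k) ζ z).re - (ρ k z + (levi (ρ k) z (ζ - z)).re) with hX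
    have h2 : |θ k * (ρ k z + X)| ≤ |ρ k z| + c₀ / (4 * m) * ‖ζ - z‖ ^ 2 := by
      rw [abs_mul]
      exact (mul_le_of_le_one_left (abs_nonneg _) (hθk k)).trans
        ((abs_add_le _ _).trans (by gcongr))
    have h3 : 2 * (θ k * (FF (ρ k) ζ z).re) =
        θ k * (levi (ρ k) z (ζ - z)).re + θ k * (ρ k z + X) := by
      rw [hX]
      ring
    linarith [neg_abs_le (θ k * (ρ k z + X))]
  have hsum := Finset.sum_le_sum fun k (_ : k ∈ Finset.univ) => hterm k
  have hconst : (m : ℝ) * (c₀ / (4 * m) * ‖ζ - z‖ ^ 2) = c₀ / 4 * ‖ζ - z‖ ^ 2 := by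
    field_simp
  rw [Finset.sum_sub_distrib, Finset.sum_sub_distrib, Finset.sum_const,
    Finset.card_univ, Fintype.card_fin, nsmul_eq_mul, hconst, ← Finset.mul_sum] at hsum
  have hL := hLevi θ hθ z hzU (ζ - z)
  simp only [Complex.re_sum, Complex.re_ofReal_mul] at hL
  have hA : 0 ≤ AA a θ z (ζ - z) := Finset.sum_nonneg fun j _ => by positivity
  have hΦ : (PhiTheta ρ a θ ζ z).re = ∑ k, θ k * (FF (ρ k) ζ z).re + AA a θ z (ζ - z) := by
    simp only [PhiTheta, Complex.add_re, Complex.re_sum, Complex.re_ofReal_mul, Complex.ofReal_re]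
  have hw2 : R ^ 2 / 4 ≤ ‖ζ - z‖ ^ 2 := by nlinarith
  have hcw := mul_le_mul_of_nonneg_left hw2 hc₀.le
  have hρz := hball z hzr
  have hcR : 0 < c₀ * R ^ 2 := by positivity
  rw [hΦ]
  linarith
end

section
/- There exist a radius R₁ > 0 with B(z₀, R₁) ⊂ 𝒰 and a constant C > 0 such that Re Φ_θ(ζ, z) ≥ C·|ζ − z|² − ρ(z) for every unit vector θ ∈ 𝕊^{m−1}, every ζ ∈ M ∩ B(z₀, R₁), and every z ∈ B(z₀, R₁). -/
open Metric

/-- Expansion of a real-linear map along the real basis `e_i, √−1·e_i` of `ℂ^n`. -/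
lemma map_eq_sum_re_im {n : ℕ} (l : EuclideanSpace ℂ (Fin n) →L[ℝ] ℂ)
    (w : EuclideanSpace ℂ (Fin n)) :
    l w = ∑ i, (((w i).re : ℂ) * l (EuclideanSpace.single i 1) +
      ((w i).im : ℂ) * l (EuclideanSpace.single i Complex.I)) := by
  have hw : w = ∑ i, ((w i).re • EuclideanSpace.single i (1 : ℂ) +
      (w i).im • EuclideanSpace.single i Complex.I) := by
    ext j
    simp [WithLp.ofLp_sum, Finset.sum_apply, Finset.sum_add_distrib, Pi.single_apply]
  conv_lhs => rw [hw]
  simp only [map_sum, map_add, map_smul, Complex.real_smul]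

lemma sum_sub_I_mul {n : ℕ} (l : EuclideanSpace ℂ (Fin n) →L[ℝ] ℂ)
    (w : EuclideanSpace ℂ (Fin n)) :
    ∑ i, (1 / 2 : ℂ) * (l (EuclideanSpace.single i 1) -
      Complex.I * l (EuclideanSpace.single i Complex.I)) * w i =
      (1 / 2 : ℂ) * (l w - Complex.I * l (Complex.I • w)) := by
  rw [map_eq_sum_re_im l w, map_eq_sum_re_im l (Complex.I • w), Finset.mul_sum,
    ← Finset.sum_sub_distrib, Finset.mul_sum]
  refine Finset.sum_congr rfl fun i _ => ?_
  conv_lhs => rw [← Complex.re_add_im (w i)]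
  simp only [PiLp.smul_apply, smul_eq_mul, Complex.mul_re, Complex.mul_im, Complex.I_re,
    Complex.I_im]
  push_cast
  linear_combination (-(1 / 2 : ℂ) * (w i).im * l (EuclideanSpace.single i Complex.I)) * Complex.I_sq

lemma sum_add_I_mul_conj {n : ℕ} (l : EuclideanSpace ℂ (Fin n) →L[ℝ] ℂ)
    (w : EuclideanSpace ℂ (Fin n)) :
    ∑ i, (1 / 2 : ℂ) * (l (EuclideanSpace.single i 1) +
      Complex.I * l (EuclideanSpace.single i Complex.I)) * (starRingEnd ℂ) (w i) =
      (1 / 2 : ℂ) * (l w + Complex.I * l (Complex.I • w)) := by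
  rw [map_eq_sum_re_im l w, map_eq_sum_re_im l (Complex.I • w), Finset.mul_sum,
    ← Finset.sum_add_distrib, Finset.mul_sum]
  refine Finset.sum_congr rfl fun i _ => ?_
  have h : (starRingEnd ℂ) (w i) = (w i).re - (w i).im * Complex.I := by
    apply Complex.ext <;> simp
  rw [h]
  simp only [PiLp.smul_apply, smul_eq_mul, Complex.mul_re, Complex.mul_im, Complex.I_re,
    Complex.I_im]
  push_cast
  linear_combination (-(1 / 2 : ℂ) * (w i).im * l (EuclideanSpace.single i Complex.I)) *
    Complex.I_sq

lemma fderiv_wz_apply {n : ℕ} {g : EuclideanSpace ℂ (Fin n) → ℂ} {z : EuclideanSpace ℂ (Fin n)}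
    (hg : DifferentiableAt ℝ (fderiv ℝ g) z) (j : Fin n) (v : EuclideanSpace ℂ (Fin n)) :
    fderiv ℝ (fun u => wz g j u) z v =
      (1 / 2 : ℂ) * (fderiv ℝ (fderiv ℝ g) z v (EuclideanSpace.single j 1) -
        Complex.I * fderiv ℝ (fderiv ℝ g) z v (EuclideanSpace.single j Complex.I)) := by
  have h (e : EuclideanSpace ℂ (Fin n)) := hg.hasFDerivAt.clm_apply (hasFDerivAt_const e z)
  have h2 := ((h (EuclideanSpace.single j 1)).sub
    ((h (EuclideanSpace.single j Complex.I)).const_mul Complex.I)).const_mul (1 / 2 : ℂ)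
  have h3 : fderiv ℝ (fun u => wz g j u) z = _ := h2.fderiv
  rw [h3]
  simp

lemma fderiv_wzbar_apply {n : ℕ} {g : EuclideanSpace ℂ (Fin n) → ℂ}
    {z : EuclideanSpace ℂ (Fin n)}
    (hg : DifferentiableAt ℝ (fderiv ℝ g) z) (j : Fin n) (v : EuclideanSpace ℂ (Fin n)) :
    fderiv ℝ (fun u => wzbar g j u) z v =
      (1 / 2 : ℂ) * (fderiv ℝ (fderiv ℝ g) z v (EuclideanSpace.single j 1) +
        Complex.I * fderiv ℝ (fderiv ℝ g) z v (EuclideanSpace.single j Complex.I)) := by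
  have h (e : EuclideanSpace ℂ (Fin n)) := hg.hasFDerivAt.clm_apply (hasFDerivAt_const e z)
  have h2 := ((h (EuclideanSpace.single j 1)).add
    ((h (EuclideanSpace.single j Complex.I)).const_mul Complex.I)).const_mul (1 / 2 : ℂ)
  have h3 : fderiv ℝ (fun u => wzbar g j u) z = _ := h2.fderiv
  rw [h3]
  simp [mul_add]

lemma sum_wz_wz {n : ℕ} {g : EuclideanSpace ℂ (Fin n) → ℂ} {z : EuclideanSpace ℂ (Fin n)}
    (hg : DifferentiableAt ℝ (fderiv ℝ g) z) (w : EuclideanSpace ℂ (Fin n)) :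
    ∑ i, ∑ j, wz (fun u => wz g j u) i z * w i * w j =
      (1 / 2 : ℂ) * ((1 / 2 : ℂ) * (fderiv ℝ (fderiv ℝ g) z w w -
          Complex.I * fderiv ℝ (fderiv ℝ g) z w (Complex.I • w)) -
        Complex.I * ((1 / 2 : ℂ) * (fderiv ℝ (fderiv ℝ g) z (Complex.I • w) w -
          Complex.I * fderiv ℝ (fderiv ℝ g) z (Complex.I • w) (Complex.I • w)))) := by
  rw [Finset.sum_comm]
  simp only [← sum_sub_I_mul, ← Finset.sum_mul, wz.eq_1 (fun u => wz g _ u), fderiv_wz_apply hg]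
  rw [Finset.mul_sum, ← Finset.sum_sub_distrib, Finset.mul_sum]
  refine Finset.sum_congr rfl fun j _ => ?_
  have := sum_sub_I_mul (fderiv ℝ (fun u => wz g j u) z) w
  simp only [fderiv_wz_apply hg] at this
  rw [this]
  ring

lemma sum_wz_wzbar {n : ℕ} {g : EuclideanSpace ℂ (Fin n) → ℂ} {z : EuclideanSpace ℂ (Fin n)}
    (hg : DifferentiableAt ℝ (fderiv ℝ g) z) (w : EuclideanSpace ℂ (Fin n)) :
    ∑ i, ∑ j, wz (fun u => wzbar g j u) i z * w i * (starRingEnd ℂ) (w j) =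
      (1 / 2 : ℂ) * ((1 / 2 : ℂ) * (fderiv ℝ (fderiv ℝ g) z w w +
          Complex.I * fderiv ℝ (fderiv ℝ g) z w (Complex.I • w)) -
        Complex.I * ((1 / 2 : ℂ) * (fderiv ℝ (fderiv ℝ g) z (Complex.I • w) w +
          Complex.I * fderiv ℝ (fderiv ℝ g) z (Complex.I • w) (Complex.I • w)))) := by
  rw [Finset.sum_comm]
  simp only [← sum_add_I_mul_conj, ← Finset.sum_mul, wz, fderiv_wzbar_apply hg]
  rw [Finset.mul_sum, ← Finset.sum_sub_distrib, Finset.mul_sum]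
  refine Finset.sum_congr rfl fun j _ => ?_
  have := sum_sub_I_mul (fderiv ℝ (fun u => wzbar g j u) z) w
  simp only [fderiv_wzbar_apply hg] at this
  rw [this]
  ring

/-- Real part of the Levi polynomial `F` in terms of the second-order Taylor polynomial
and the Levi form. -/
lemma re_FF {n : ℕ} {f : EuclideanSpace ℂ (Fin n) → ℝ} {z : EuclideanSpace ℂ (Fin n)}
    (hf : ContDiffAt ℝ 2 f z) (ζ : EuclideanSpace ℂ (Fin n)) :
    (FF f ζ z).re = -(1 / 2) * (fderiv ℝ f z (ζ - z) +
      1 / 2 * fderiv ℝ (fderiv ℝ f) z (ζ - z) (ζ - z)) + 1 / 2 * (levi f z (ζ - z)).re := by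
  set g : EuclideanSpace ℂ (Fin n) → ℂ := fun v => ((f v : ℝ) : ℂ) with hgdef
  have hev : ∀ᶠ u in nhds z, fderiv ℝ g u = Complex.ofRealCLM.comp (fderiv ℝ f u) := by
    filter_upwards [hf.eventually (by simp)] with u hu
    exact (Complex.ofRealCLM.hasFDerivAt.comp u
      (hu.differentiableAt (by norm_num)).hasFDerivAt).fderiv
  have hD : DifferentiableAt ℝ (fderiv ℝ f) z :=
    (hf.fderiv_right (m := 1) (by norm_num)).differentiableAt (by norm_num)
  have hG : HasFDerivAt (fderiv ℝ g) _ z :=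
    ((ContinuousLinearMap.compL ℝ (EuclideanSpace ℂ (Fin n)) ℝ ℂ
      Complex.ofRealCLM).hasFDerivAt.comp z hD.hasFDerivAt).congr_of_eventuallyEq hev
  have h2 (v w : EuclideanSpace ℂ (Fin n)) :
      fderiv ℝ (fderiv ℝ g) z v w = ((fderiv ℝ (fderiv ℝ f) z v w : ℝ) : ℂ) := by
    rw [hG.fderiv]; simp
  have h1 (v : EuclideanSpace ℂ (Fin n)) : fderiv ℝ g z v = ((fderiv ℝ f z v : ℝ) : ℂ) := by
    rw [hev.self_of_nhds]; simp
  have hFF : FF f ζ z = -(∑ i, wz g i z * (ζ - z) i) -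
      (1 / 2 : ℂ) * ∑ i, ∑ j, wz (fun u => wz g j u) i z * (ζ - z) i * (ζ - z) j := by
    simp only [FF, QQ, ← hgdef]
    rw [← Finset.sum_neg_distrib, Finset.mul_sum, ← Finset.sum_sub_distrib]
    refine Finset.sum_congr rfl fun i _ => ?_
    simp only [PiLp.sub_apply, sub_mul, neg_mul, Finset.sum_mul, Finset.mul_sum]
    congr 1
    refine Finset.sum_congr rfl fun j _ => ?_
    ring
  rw [hFF, levi, sum_wz_wz hG.differentiableAt, sum_wz_wzbar hG.differentiableAt]
  simp only [wz]
  rw [sum_sub_I_mul]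
  simp only [h1, h2]
  simp
  ring

/-- Second-order Taylor estimate on a ball where the second derivative oscillates little. -/
lemma abs_taylor_two_le {E : Type*} [NormedAddCommGroup E] [NormedSpace ℝ E] {f : E → ℝ}
    {z₀ : E} {r ε : ℝ} (hf : ∀ x ∈ ball z₀ r, ContDiffAt ℝ 2 f x)
    (hε : ∀ x ∈ ball z₀ r, ∀ y ∈ ball z₀ r,
      dist (fderiv ℝ (fderiv ℝ f) x) (fderiv ℝ (fderiv ℝ f) y) ≤ ε)
    {z ζ : E} (hz : z ∈ ball z₀ r) (hζ : ζ ∈ ball z₀ r) :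
    |f ζ - f z - fderiv ℝ f z (ζ - z) - 1 / 2 * fderiv ℝ (fderiv ℝ f) z (ζ - z) (ζ - z)|
      ≤ ε * ‖ζ - z‖ ^ 2 := by
  have hε0 : 0 ≤ ε := dist_nonneg.trans (hε z hz z hz)
  set B := fderiv ℝ (fderiv ℝ f) z with hB
  have hsymm (v w : E) : B v w = B w v :=
    ((hf z hz).isSymmSndFDerivAt (by simp)) v w
  have hd (x) (hx : x ∈ ball z₀ r) : HasFDerivAt (fderiv ℝ f) (fderiv ℝ (fderiv ℝ f) x) x :=
    (((hf x hx).fderiv_right (m := 1) (by norm_num)).differentiableAt (by norm_num)).hasFDerivAt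
  have hfirst (x) (hx : x ∈ ball z₀ r) : ‖fderiv ℝ f x - fderiv ℝ f z - B (x - z)‖ ≤
      ε * ‖x - z‖ := by
    have := (convex_ball z₀ r).norm_image_sub_le_of_norm_hasFDerivWithin_le
      (f := fun y => fderiv ℝ f y - B y) (f' := fun y => fderiv ℝ (fderiv ℝ f) y - B)
      (fun y hy => ((hd y hy).sub B.hasFDerivAt).hasFDerivWithinAt)
      (fun y hy => (dist_eq_norm _ _).symm.le.trans (hε y hy z hz)) hz hx
    simpa [sub_sub_sub_comm] using this
  have hseg (x) (hx : x ∈ segment ℝ z ζ) : ‖x - z‖ ≤ ‖ζ - z‖ := by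
    simpa [norm_sub_rev] using norm_sub_le_of_mem_segment hx
  have hsub : segment ℝ z ζ ⊆ ball z₀ r := (convex_ball z₀ r).segment_subset hz hζ
  have key := (convex_segment z ζ).norm_image_sub_le_of_norm_hasFDerivWithin_le
      (f := fun y => f y - fderiv ℝ f z y - 1 / 2 * B (y - z) (y - z))
      (f' := fun y => fderiv ℝ f y - fderiv ℝ f z - B (y - z)) (C := ε * ‖ζ - z‖)
      (fun y hy => ?_)
      (fun y hy => (hfirst y (hsub hy)).trans (by gcongr; exact hseg y hy))
      (left_mem_segment ℝ z ζ) (right_mem_segment ℝ z ζ)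
  · rw [Real.norm_eq_abs] at key
    convert key using 1
    · congr 1
      simp
      ring
    · ring
  · have hi : HasFDerivAt (fun y => y - z) (ContinuousLinearMap.id ℝ E) y :=
      (hasFDerivAt_id y).sub_const z
    have hq := ((B.hasFDerivAt.comp y hi).clm_apply hi).const_mul (1 / 2 : ℝ)
    have h := ((((hf y (hsub hy)).differentiableAt (by norm_num)).hasFDerivAt.sub
      (fderiv ℝ f z).hasFDerivAt).sub hq).hasFDerivWithinAt (s := segment ℝ z ζ)
    refine h.congr_fderiv ?_
    ext v
    have := hsymm v (y - z)
    simp only [sub_apply, smul_apply,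
      add_apply, ContinuousLinearMap.comp_apply,
      ContinuousLinearMap.flip_apply, ContinuousLinearMap.id_apply, Function.comp_apply,
      smul_eq_mul, this]
    ring

lemma AA_nonneg {n m N' : ℕ}
    (a : Fin N' → EuclideanSpace ℝ (Fin m) → EuclideanSpace ℂ (Fin n) → EuclideanSpace ℂ (Fin n))
    (θ : EuclideanSpace ℝ (Fin m)) (z w : EuclideanSpace ℂ (Fin n)) : 0 ≤ AA a θ z w :=
  Finset.sum_nonneg fun _ _ => by positivity

/-- A common ball around `z₀` on which the second derivatives of finitely many `C²` functions
oscillate by at most `ε`. -/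
lemma exists_ball_dist_sndFDeriv_le {E ι : Type*} [NormedAddCommGroup E] [NormedSpace ℝ E]
    [Finite ι] {f : ι → E → ℝ} {U : Set E} (hU : IsOpen U) {z₀ : E} (hz₀ : z₀ ∈ U)
    (hf : ∀ k, ContDiffOn ℝ 2 (f k) U) {ε : ℝ} (hε : 0 < ε) :
    ∃ r, 0 < r ∧ ball z₀ r ⊆ U ∧ ∀ k, ∀ x ∈ ball z₀ r, ∀ y ∈ ball z₀ r,
      dist (fderiv ℝ (fderiv ℝ (f k)) x) (fderiv ℝ (fderiv ℝ (f k)) y) ≤ ε := by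
  have hc (k) : ∀ᶠ x in nhds z₀, dist (fderiv ℝ (fderiv ℝ (f k)) x)
      (fderiv ℝ (fderiv ℝ (f k)) z₀) < ε / 2 := by
    have h : ContDiffAt ℝ 0 (fderiv ℝ (fderiv ℝ (f k))) z₀ :=
      (((hf k).contDiffAt (hU.mem_nhds hz₀)).fderiv_right (m := 1) (by norm_num)).fderiv_right
        (by norm_num)
    exact h.continuousAt.eventually (ball_mem_nhds _ (half_pos hε))
  obtain ⟨r, hr, hball⟩ := Metric.eventually_nhds_iff_ball.1
    ((hU.eventually_mem hz₀).and (Filter.eventually_all.2 hc))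
  refine ⟨r, hr, fun x hx => (hball x hx).1, fun k x hx y hy => ?_⟩
  linarith [dist_triangle_right (fderiv ℝ (fderiv ℝ (f k)) x) (fderiv ℝ (fderiv ℝ (f k)) y)
    (fderiv ℝ (fderiv ℝ (f k)) z₀), (hball x hx).2 k, (hball y hy).2 k]

/-- on a small ball around `z₀`,
`Re Φ_θ(ζ,z) ≥ C·|ζ−z|² − ρ(z)` for all unit `θ`, all `ζ ∈ M` and all `z` in the ball. -/
theorem versal_stmt_7 (n m q : ℕ) (hm : 1 ≤ m) (hq : 1 ≤ q) (hqm : q + m ≤ n)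
    (U : Set (EuclideanSpace ℂ (Fin n))) (hU : IsOpen U)
    (z₀ : EuclideanSpace ℂ (Fin n)) (hz₀ : z₀ ∈ U)
    (ρ : Fin m → EuclideanSpace ℂ (Fin n) → ℝ)
    (hρ : ∀ k, ContDiffOn ℝ 3 (ρ k) U)
    (hρb : ∀ k, ∃ K : ℝ, ∀ i ≤ 3, ∀ x ∈ U, ‖iteratedFDerivWithin ℝ i (ρ k) U x‖ ≤ K)
    (hz₀M : ∀ k, ρ k z₀ = 0)
    (a : Fin (n - q - m) →
      EuclideanSpace ℝ (Fin m) → EuclideanSpace ℂ (Fin n) → EuclideanSpace ℂ (Fin n))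
    (ha : ∀ j, ContinuousOn
      (fun p : EuclideanSpace ℝ (Fin m) × EuclideanSpace ℂ (Fin n) => a j p.1 p.2)
      (sphere (0 : EuclideanSpace ℝ (Fin m)) 1 ×ˢ U))
    (hab : ∀ j, ∃ B : ℝ, ∀ θ ∈ sphere (0 : EuclideanSpace ℝ (Fin m)) 1, ∀ z ∈ U,
      ‖a j θ z‖ ≤ B)
    (c₀ : ℝ) (hc₀ : 0 < c₀)
    (hLevi : ∀ θ : EuclideanSpace ℝ (Fin m), ‖θ‖ = 1 → ∀ z ∈ U,
      ∀ w : EuclideanSpace ℂ (Fin n),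
        c₀ * ‖w‖ ^ 2 ≤ (∑ k, ((θ k : ℝ) : ℂ) * levi (ρ k) z w).re + AA a θ z w) :
    ∃ R₁ : ℝ, 0 < R₁ ∧ ball z₀ R₁ ⊆ U ∧ ∃ C : ℝ, 0 < C ∧
      ∀ θ : EuclideanSpace ℝ (Fin m), ‖θ‖ = 1 →
        ∀ ζ ∈ ball z₀ R₁, (∀ k, ρ k ζ = 0) →
          ∀ z ∈ ball z₀ R₁,
            C * ‖ζ - z‖ ^ 2 - Real.sqrt (∑ k, ρ k z ^ 2) ≤ (PhiTheta ρ a θ ζ z).re := by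
  have hm' : (0 : ℝ) < m := by exact_mod_cast hm
  have hρ2 (k) : ContDiffOn ℝ 2 (ρ k) U := (hρ k).of_le (by norm_num)
  obtain ⟨r, hr, hrU, hosc⟩ :=
    exists_ball_dist_sndFDeriv_le hU hz₀ hρ2 (ε := c₀ / (2 * m)) (by positivity)
  refine ⟨r, hr, hrU, c₀ / 4, by positivity, fun θ hθ ζ hζ hM z hz => ?_⟩
  have hC2 (k) (x) (hx : x ∈ ball z₀ r) : ContDiffAt ℝ 2 (ρ k) x :=
    (hρ2 k).contDiffAt (hU.mem_nhds (hrU hx))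
  have hL := hLevi θ hθ z (hrU hz) (ζ - z)
  have hA := AA_nonneg a θ z (ζ - z)
  have hθk (k) : |θ k| ≤ 1 := hθ ▸ PiLp.norm_apply_le θ k
  set S := Real.sqrt (∑ k, ρ k z ^ 2) with hS
  have hS0 : 0 ≤ S := Real.sqrt_nonneg _
  have hCS : -S ≤ ∑ k, θ k * ρ k z := by
    have h := abs_real_inner_le_norm θ (WithLp.toLp 2 fun k => ρ k z)
    rw [hθ, one_mul, EuclideanSpace.norm_eq] at h
    simp only [PiLp.inner_apply, Real.norm_eq_abs, sq_abs, RCLike.inner_apply, conj_trivial] at h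
    rw [← hS] at h
    simpa [mul_comm] using (abs_le.1 h).1
  have hterm (k) : θ k * (FF (ρ k) ζ z).re ≥ 1 / 2 * (θ k * ρ k z) +
      1 / 2 * (θ k * (levi (ρ k) z (ζ - z)).re) - c₀ / (4 * m) * ‖ζ - z‖ ^ 2 := by
    have hT := abs_taylor_two_le (hC2 k) (hosc k) hz hζ
    rw [re_FF (hC2 k z hz) ζ]
    rw [hM k] at hT
    set T := 0 - ρ k z - fderiv ℝ (ρ k) z (ζ - z) -
      1 / 2 * fderiv ℝ (fderiv ℝ (ρ k)) z (ζ - z) (ζ - z) with hTdef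
    have h1 : |θ k * T| ≤ c₀ / (2 * m) * ‖ζ - z‖ ^ 2 := by
      rw [abs_mul]
      exact (mul_le_of_le_one_left (abs_nonneg _) (hθk k)).trans hT
    have h2 := (abs_le.1 h1).1
    have h3 : c₀ / (2 * m) = 2 * (c₀ / (4 * m)) := by field_simp; norm_num
    rw [h3] at h2
    have h4 : fderiv ℝ (ρ k) z (ζ - z) +
      1 / 2 * fderiv ℝ (fderiv ℝ (ρ k)) z (ζ - z) (ζ - z) = - ρ k z - T := by
      rw [hTdef]; ring
    rw [h4]
    linarith
  have hsum := Finset.sum_le_sum fun k (_ : k ∈ Finset.univ) => hterm k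
  simp only [Finset.sum_sub_distrib, Finset.sum_add_distrib, ← Finset.mul_sum, Finset.sum_const,
    Finset.card_univ, Fintype.card_fin, nsmul_eq_mul] at hsum
  have h5 : c₀ / (4 * m) * (m * ‖ζ - z‖ ^ 2) = c₀ / 4 * ‖ζ - z‖ ^ 2 := by
    field_simp
  rw [h5] at hsum
  simp only [PhiTheta, Complex.add_re, Complex.re_sum, Complex.re_ofReal_mul,
    Complex.ofReal_re] at hL ⊢
  linarith
end

section
/- Let H be a Hermitian form on ℂ^n, let ℓ₁,…,ℓ_m be linearly independent ℂ-linear functionals on ℂ^n, and let E ⊆ ⋂_{i=1}^m ker ℓ_i be a complex subspace of dimension q on which H is positive definite. Then there exist a complex subspace F of ℂ^n with E ⊆ F and dim_ℂ F = q + m, and a constant A₀ ≥ 0, such that for every real A ≥ A₀ the Hermitian form w ↦ H(w) + A·∑_{i=1}^m |ℓ_i(w)|² is positive definite on F. -/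
/-- On a compact set, a continuous function `f` that is positive on the zero set of a nonnegative
continuous function `g` becomes positive everywhere after adding a large multiple of `g`. -/
theorem IsCompact.exists_forall_pos_add_mul {X : Type*} [TopologicalSpace X] {K : Set X}
    (hK : IsCompact K) {f g : X → ℝ} (hf : Continuous f) (hg : Continuous g)
    (hg0 : ∀ x ∈ K, 0 ≤ g x) (hfg : ∀ x ∈ K, g x = 0 → 0 < f x) :
    ∃ C : ℝ, 0 ≤ C ∧ ∀ A : ℝ, C ≤ A → ∀ x ∈ K, 0 < f x + A * g x := by
  have hK' : IsCompact (K ∩ {x | f x ≤ 0}) := hK.inter_right (isClosed_le hf continuous_const)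
  have hgpos : ∀ x ∈ K ∩ {x | f x ≤ 0}, 0 < g x := fun x hx ↦
    (hg0 x hx.1).lt_of_ne' fun h0 ↦ (hfg x hx.1 h0).not_ge hx.2
  obtain ⟨B, hB⟩ := hK'.bddAbove_image (f := fun x ↦ -f x / g x)
    (hf.neg.continuousOn.div hg.continuousOn fun x hx ↦ (hgpos x hx).ne')
  refine ⟨max B 0 + 1, by positivity, fun A hA x hx ↦ ?_⟩
  have hA0 : 0 ≤ A := by linarith [le_max_right B 0]
  rcases lt_or_ge 0 (f x) with hfx | hfx
  · exact add_pos_of_pos_of_nonneg hfx (mul_nonneg hA0 (hg0 x hx))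
  · have hgx := hgpos x ⟨hx, hfx⟩
    have hBx : -f x / g x ≤ B := hB ⟨x, ⟨hx, hfx⟩, rfl⟩
    have hlt : -f x / g x < A := by linarith [le_max_left B 0]
    linarith [(div_lt_iff₀ hgx).1 hlt]

/-- If `f` and `g` are continuous and homogeneous of degree two on a finite-dimensional complex
space, `g` is nonnegative and `f` is positive on the nonzero zeros of `g` in the subspace `F`, then
`f + A * g` is positive on `F \ {0}` for all large `A`. -/
theorem Submodule.exists_forall_pos_add_mul {V : Type*} [NormedAddCommGroup V] [NormedSpace ℂ V]
    [FiniteDimensional ℂ V] (F : Submodule ℂ V) {f g : V → ℝ}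
    (hf : Continuous f) (hg : Continuous g)
    (hf2 : ∀ (r : ℝ) (w : V), f ((r : ℂ) • w) = r ^ 2 * f w)
    (hg2 : ∀ (r : ℝ) (w : V), g ((r : ℂ) • w) = r ^ 2 * g w)
    (hg0 : ∀ w, 0 ≤ g w) (hfg : ∀ w ∈ F, w ≠ 0 → g w = 0 → 0 < f w) :
    ∃ C : ℝ, 0 ≤ C ∧ ∀ A : ℝ, C ≤ A → ∀ w ∈ F, w ≠ 0 → 0 < f w + A * g w := by
  have := FiniteDimensional.proper ℂ V
  have hK : IsCompact (Metric.sphere (0 : V) 1 ∩ F) :=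
    (isCompact_sphere 0 1).inter_right F.closed_of_finiteDimensional
  obtain ⟨C, hC, h⟩ := hK.exists_forall_pos_add_mul hf hg (fun x _ ↦ hg0 x)
    fun x hx ↦ hfg x hx.2 (ne_zero_of_mem_unit_sphere ⟨x, hx.1⟩)
  refine ⟨C, hC, fun A hA w hw hw0 ↦ ?_⟩
  have hpos : 0 < ‖w‖ := norm_pos_iff.2 hw0
  have hu := h A hA (((‖w‖⁻¹ : ℝ) : ℂ) • w) ⟨by simp [norm_smul, hpos.ne'], F.smul_mem _ hw⟩
  rw [hf2, hg2] at hu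
  refine pos_of_mul_pos_right (a := ‖w‖⁻¹ ^ 2) ?_ (by positivity)
  linarith

/-- Linearly independent functionals are jointly surjective. -/
theorem LinearMap.pi_surjective_of_linearIndependent {K V ι : Type*} [Field K] [AddCommGroup V]
    [Module K V] [Finite ι] {ℓ : ι → V →ₗ[K] K} (hℓ : LinearIndependent K ℓ) :
    Function.Surjective (LinearMap.pi ℓ) := by
  have := Fintype.ofFinite ι
  classical
  rw [← LinearMap.dualMap_injective_iff, injective_iff_map_eq_zero]
  intro φ hφ
  have hsum : ∑ i, φ (Pi.single i 1) • ℓ i = 0 := by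
    ext v
    have hv : φ (LinearMap.pi ℓ v) = 0 := LinearMap.congr_fun hφ v
    rw [LinearMap.pi_apply_eq_sum_univ φ] at hv
    have hsingle (i : ι) : (fun j ↦ if i = j then (1 : K) else 0) = Pi.single i 1 := by
      ext j
      simp [Pi.single_apply, eq_comm]
    simpa [mul_comm, hsingle] using hv
  have h0 := Fintype.linearIndependent_iff.1 hℓ _ hsum
  ext i
  simpa using h0 i

/-- A subspace of the kernel of a surjection `L` onto a finite-dimensional space extends, by the
dimension of the target, to a subspace meeting the kernel only in the original one. -/
theorem LinearMap.exists_extend_of_le_ker {K V W : Type*} [Field K] [AddCommGroup V] [Module K V]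
    [FiniteDimensional K V] [AddCommGroup W] [Module K W]
    {L : V →ₗ[K] W} (hL : Function.Surjective L) {E : Submodule K V} (hE : E ≤ L.ker) :
    ∃ F : Submodule K V, E ≤ F ∧ Module.finrank K F = Module.finrank K E + Module.finrank K W ∧
      F ⊓ L.ker = E := by
  obtain ⟨s, hs⟩ := L.exists_rightInverse_of_surjective (LinearMap.range_eq_top.2 hL)
  have hLs : Function.LeftInverse L s := fun y ↦ LinearMap.congr_fun hs y
  have hdisj : s.range ⊓ L.ker = ⊥ := by
    rw [eq_bot_iff]
    rintro _ ⟨⟨y, rfl⟩, hy⟩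
    have : y = 0 := by rw [← hLs y]; exact hy
    simp [this]
  refine ⟨E ⊔ s.range, le_sup_left, ?_, ?_⟩
  · have hinf : E ⊓ s.range = ⊥ := by
      rw [eq_bot_iff, ← hdisj, inf_comm]
      exact inf_le_inf_left _ hE
    have := Submodule.finrank_sup_add_finrank_inf_eq E s.range
    rwa [hinf, finrank_bot, add_zero, LinearMap.finrank_range_of_inj hLs.injective] at this
  · rw [sup_inf_assoc_of_le _ hE, hdisj, sup_bot_eq]


/-- Kohn-lemma linear algebra: a Hermitian form positive definite on a
`q`-dimensional subspace `E` of the common kernel of `m` independent linear functionals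
becomes, after adding `A·∑|ℓ_i|²` for large `A`, positive definite on a `(q+m)`-dimensional
subspace `F ⊇ E`. -/
theorem versal_stmt_9 (n m q : ℕ)
    (h : Matrix (Fin n) (Fin n) ℂ) (hherm : h.IsHermitian)
    (ℓ : Fin m → ((Fin n → ℂ) →ₗ[ℂ] ℂ)) (hℓ : LinearIndependent ℂ ℓ)
    (E : Submodule ℂ (Fin n → ℂ))
    (hEker : ∀ w ∈ E, ∀ i, ℓ i w = 0)
    (hEdim : Module.finrank ℂ E = q)
    (hpos : ∀ w ∈ E, w ≠ 0 →
      0 < (∑ i, ∑ j, h i j * w i * (starRingEnd ℂ) (w j)).re) :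
    ∃ F : Submodule ℂ (Fin n → ℂ), E ≤ F ∧ Module.finrank ℂ F = q + m ∧
      ∃ A₀ : ℝ, 0 ≤ A₀ ∧ ∀ A : ℝ, A₀ ≤ A → ∀ w ∈ F, w ≠ 0 →
        0 < (∑ i, ∑ j, h i j * w i * (starRingEnd ℂ) (w j)).re +
          A * ∑ i, ‖ℓ i w‖ ^ 2 := by
  have hE : E ≤ (LinearMap.pi ℓ).ker := fun w hw ↦ funext (hEker w hw)
  obtain ⟨F, hEF, hFdim, hFker⟩ := LinearMap.exists_extend_of_le_ker
    (LinearMap.pi_surjective_of_linearIndependent hℓ) hE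
  refine ⟨F, hEF, by simpa [hEdim] using hFdim, ?_⟩
  have hℓc (i : Fin m) : Continuous (ℓ i) := (ℓ i).continuous_of_finiteDimensional
  refine F.exists_forall_pos_add_mul
    (f := fun w ↦ (∑ i, ∑ j, h i j * w i * (starRingEnd ℂ) (w j)).re)
    (g := fun w ↦ ∑ i, ‖ℓ i w‖ ^ 2) ?_ (by fun_prop) ?_ ?_ (fun w ↦ by positivity) ?_
  · exact Complex.continuous_re.comp (by fun_prop)
  · intro r w
    rw [← Complex.re_ofReal_mul, Finset.mul_sum]
    congr 1
    refine Finset.sum_congr rfl fun i _ ↦ ?_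
    rw [Finset.mul_sum]
    refine Finset.sum_congr rfl fun j _ ↦ ?_
    simp only [Pi.smul_apply, smul_eq_mul, map_mul, Complex.conj_ofReal, Complex.ofReal_pow]
    ring
  · intro r w
    simp [Finset.mul_sum, mul_pow]
  · intro w hw hw0 hg
    refine hpos w ?_ hw0
    rw [← hFker]
    refine ⟨hw, funext fun i ↦ ?_⟩
    have := (Finset.sum_eq_zero_iff_of_nonneg fun i _ ↦ by positivity).1 hg i (Finset.mem_univ i)
    simpa using this
end

section
/- Let V ⊆ ℝ^d be open, let k ≥ 0 be an integer, and let A : V → M_N(ℂ) be of class C^k with sup_{z∈V} ‖A(z)‖ ≤ 1/2 and |A|_{V,k} < ∞. Then I + A(z) is invertible for every z ∈ V, the map z ↦ (I + A(z))^{−1} − I is of class C^k on V, and there exists a constant C depending only on k, d, N such that |(I + A)^{−1} − I|_{V,k} ≤ C·(1 + |A|_{V,k})^{k}·|A|_{V,k}. -/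
open Metric

/-- The `C^k`-norm of a function `u` on a set `V`. -/
noncomputable def cnorm {H E : Type*} [NormedAddCommGroup H] [NormedSpace ℝ H]
    [NormedAddCommGroup E] [NormedSpace ℝ E] (k : ℕ) (V : Set H) (u : H → E) : ℝ :=
  ⨆ (i : Fin (k + 1)) (x : V), ‖iteratedFDerivWithin ℝ (i : ℕ) u V (x : H)‖

/-- If `B = -A - A * B` on an open set and `‖A‖ ≤ 1 / 2` there, the derivatives of `B` are tamely
controlled by those of `A`: in the Leibniz expansion of `A * B` the top-order term
is absorbed in the left-hand side. -/
theorem exists_norm_iteratedFDerivWithin_le_of_eq_neg_sub_mul {H R : Type*}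
    [NormedAddCommGroup H] [NormedSpace ℝ H] [NormedRing R] [NormedAlgebra ℝ R] (n : ℕ) :
    ∃ C : ℝ, 0 < C ∧ ∀ (V : Set H) (A B : H → R) (M : ℝ), IsOpen V →
      ContDiffOn ℝ n A V → ContDiffOn ℝ n B V →
      (∀ z ∈ V, B z = -A z - A z * B z) → (∀ z ∈ V, ‖A z‖ ≤ 1 / 2) →
      (∀ i ≤ n, ∀ x ∈ V, ‖iteratedFDerivWithin ℝ i A V x‖ ≤ M) →
      ∀ i ≤ n, ∀ x ∈ V, ‖iteratedFDerivWithin ℝ i B V x‖ ≤ C * (1 + M) ^ i * M := by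
  induction n with
  | zero =>
    refine ⟨2, two_pos, fun V A B M _ _ _ hAB hA hM i hi x hx => ?_⟩
    obtain rfl : i = 0 := by omega
    have h1 := hM 0 le_rfl x hx
    rw [norm_iteratedFDerivWithin_zero] at h1 ⊢
    have h2 : ‖B x‖ ≤ ‖A x‖ + ‖A x‖ * ‖B x‖ := by
      calc ‖B x‖ = ‖-A x - A x * B x‖ := by rw [← hAB x hx]
        _ ≤ ‖-A x‖ + ‖A x * B x‖ := norm_sub_le _ _
        _ ≤ _ := by rw [norm_neg]; gcongr; exact norm_mul_le _ _
    nlinarith [hA x hx, norm_nonneg (B x), norm_nonneg (A x)]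
  | succ n ih =>
    obtain ⟨C, hC, ih⟩ := ih
    refine ⟨C + 2 + 2 * (2 ^ (n + 1) * C), by positivity,
      fun V A B M hV hcA hcB hAB hA hM i hi x hx => ?_⟩
    have hM0 : 0 ≤ M := (norm_nonneg _).trans (hM 0 (by omega) x hx)
    have ih' := ih V A B M hV (hcA.of_le (by norm_cast; omega)) (hcB.of_le (by norm_cast; omega))
      hAB hA (fun i hi => hM i (by omega))
    rcases Nat.lt_or_ge i (n + 1) with hlt | hge
    · refine (ih' i (by omega) x hx).trans ?_
      gcongr
      have : 0 < 2 * (2 ^ (n + 1) * C) := by positivity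
      linarith
    obtain rfl : i = n + 1 := le_antisymm hi hge
    have hu : UniqueDiffOn ℝ V := hV.uniqueDiffOn
    have hcAB := hcA.mul hcB
    have hBeq : iteratedFDerivWithin ℝ (n + 1) B V x =
        -iteratedFDerivWithin ℝ (n + 1) A V x -
          iteratedFDerivWithin ℝ (n + 1) (fun z => A z * B z) V x := by
      rw [iteratedFDerivWithin_congr (f := (-A) - fun z => A z * B z) hAB hx,
        iteratedFDerivWithin_sub_apply (f := -A) (hcA.neg x hx) (hcAB x hx) hu hx,
        iteratedFDerivWithin_neg_apply hu hx]
    have hmul := norm_iteratedFDerivWithin_mul_le hcA hcB hu hx (n := n + 1) le_rfl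
    rw [Finset.sum_range_succ'] at hmul
    have hlow : ∑ j ∈ Finset.range (n + 1), ((n + 1).choose (j + 1) : ℝ) *
        ‖iteratedFDerivWithin ℝ (j + 1) A V x‖ *
          ‖iteratedFDerivWithin ℝ (n + 1 - (j + 1)) B V x‖ ≤
        2 ^ (n + 1) * C * (1 + M) ^ (n + 1) * M := by
      calc _ ≤ ∑ j ∈ Finset.range (n + 1), ((n + 1).choose (j + 1) : ℝ) *
            (C * (1 + M) ^ (n + 1) * M) := by
            refine Finset.sum_le_sum fun j hj => ?_
            rw [Finset.mem_range] at hj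
            rw [mul_assoc]
            refine mul_le_mul_of_nonneg_left ?_ (Nat.cast_nonneg _)
            calc _ ≤ (1 + M) * (C * (1 + M) ^ n * M) := by
                  gcongr
                  · exact (hM (j + 1) (by omega) x hx).trans (by linarith)
                  · refine (ih' _ (by omega) x hx).trans ?_
                    gcongr
                    · linarith
                    · omega
              _ = _ := by ring
        _ = (∑ j ∈ Finset.range (n + 1), ((n + 1).choose (j + 1) : ℝ)) *
            (C * (1 + M) ^ (n + 1) * M) := by rw [Finset.sum_mul]
        _ ≤ 2 ^ (n + 1) * (C * (1 + M) ^ (n + 1) * M) := by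
            gcongr
            have h := Nat.sum_range_choose (n + 1)
            rw [Finset.sum_range_succ'] at h
            have h' : ∑ j ∈ Finset.range (n + 1), (n + 1).choose (j + 1) ≤ 2 ^ (n + 1) := by omega
            exact_mod_cast h'
        _ = _ := by ring
    have htop : ((n + 1).choose 0 : ℝ) * ‖iteratedFDerivWithin ℝ 0 A V x‖ *
        ‖iteratedFDerivWithin ℝ (n + 1 - 0) B V x‖ ≤
        1 / 2 * ‖iteratedFDerivWithin ℝ (n + 1) B V x‖ := by
      rw [norm_iteratedFDerivWithin_zero, Nat.choose_zero_right, Nat.cast_one, one_mul,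
        Nat.sub_zero]
      gcongr
      exact hA x hx
    have hB : ‖iteratedFDerivWithin ℝ (n + 1) B V x‖ ≤
        ‖iteratedFDerivWithin ℝ (n + 1) A V x‖ +
          ‖iteratedFDerivWithin ℝ (n + 1) (fun z => A z * B z) V x‖ := by
      rw [hBeq, ← norm_neg (iteratedFDerivWithin ℝ (n + 1) A V x)]
      exact norm_sub_le _ _
    have hA' := hM (n + 1) le_rfl x hx
    have hpow : M ≤ (1 + M) ^ (n + 1) * M :=
      le_mul_of_one_le_left hM0 (one_le_pow₀ (by linarith))
    have hCpos : 0 ≤ C * ((1 + M) ^ (n + 1) * M) := by positivity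
    linarith

theorem norm_iteratedFDerivWithin_le_cnorm {H E : Type*} [NormedAddCommGroup H] [NormedSpace ℝ H]
    [NormedAddCommGroup E] [NormedSpace ℝ E] {k : ℕ} {V : Set H} {u : H → E} {M : ℝ}
    (hM : ∀ i ≤ k, ∀ x ∈ V, ‖iteratedFDerivWithin ℝ i u V x‖ ≤ M) {i : ℕ} (hi : i ≤ k) {x : H}
    (hx : x ∈ V) : ‖iteratedFDerivWithin ℝ i u V x‖ ≤ cnorm k V u := by
  have hb : ∀ j : Fin (k + 1),
      BddAbove (Set.range fun y : V => ‖iteratedFDerivWithin ℝ (j : ℕ) u V (y : H)‖) := by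
    rintro j
    refine ⟨M, ?_⟩
    rintro _ ⟨y, rfl⟩
    exact hM j (by omega) y y.2
  refine (le_ciSup (hb ⟨i, by omega⟩) ⟨x, hx⟩).trans ?_
  exact le_ciSup (f := fun j : Fin (k + 1) =>
    ⨆ y : V, ‖iteratedFDerivWithin ℝ (j : ℕ) u V (y : H)‖)
    (Set.finite_range _).bddAbove ⟨i, by omega⟩

theorem cnorm_nonneg {H E : Type*} [NormedAddCommGroup H] [NormedSpace ℝ H]
    [NormedAddCommGroup E] [NormedSpace ℝ E] (k : ℕ) (V : Set H) (u : H → E) :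
    0 ≤ cnorm k V u :=
  Real.iSup_nonneg fun _ => Real.iSup_nonneg fun _ => norm_nonneg _

theorem exists_cnorm_ringInverse_one_add_sub_one_le (H R : Type*)
    [NormedAddCommGroup H] [NormedSpace ℝ H] [NormedRing R] [NormedAlgebra ℝ R]
    [CompleteSpace R] (k : ℕ) :
    ∃ C : ℝ, 0 < C ∧ ∀ V : Set H, IsOpen V → ∀ A : H → R, ContDiffOn ℝ k A V →
      (∀ z ∈ V, ‖A z‖ ≤ 1 / 2) →
      (∃ M : ℝ, ∀ i ≤ k, ∀ x ∈ V, ‖iteratedFDerivWithin ℝ i A V x‖ ≤ M) →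
      (∀ z ∈ V, IsUnit (1 + A z)) ∧
        ContDiffOn ℝ k (fun z => Ring.inverse (1 + A z) - 1) V ∧
        cnorm k V (fun z => Ring.inverse (1 + A z) - 1) ≤
          C * (1 + cnorm k V A) ^ k * cnorm k V A := by
  obtain ⟨C, hC, hbound⟩ :=
    exists_norm_iteratedFDerivWithin_le_of_eq_neg_sub_mul (H := H) (R := R) k
  refine ⟨C, hC, fun V hV A hcA hA ⟨M, hM⟩ => ?_⟩
  have hunit : ∀ z ∈ V, IsUnit (1 + A z) := fun z hz => by
    have h : ‖-A z‖ < 1 := by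
      rw [norm_neg]
      linarith [hA z hz]
    simpa using isUnit_one_sub_of_norm_lt_one h
  have hcB : ContDiffOn ℝ k (fun z => Ring.inverse (1 + A z) - 1) V := by
    refine ContDiffOn.sub (fun z hz => ?_) contDiffOn_const
    obtain ⟨u, hu⟩ := hunit z hz
    have hinv : ContDiffAt ℝ k Ring.inverse (1 + A z) := hu ▸ contDiffAt_ringInverse ℝ u
    exact hinv.comp_contDiffWithinAt z (contDiffWithinAt_const.add (hcA z hz))
  have h0 := cnorm_nonneg k V A
  refine ⟨hunit, hcB, ?_⟩
  have hAB : ∀ z ∈ V, Ring.inverse (1 + A z) - 1 =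
      -A z - A z * (Ring.inverse (1 + A z) - 1) := fun z hz => by
    have h := Ring.mul_inverse_cancel _ (hunit z hz)
    rw [add_mul, one_mul] at h
    rw [mul_sub, mul_one]
    generalize Ring.inverse (1 + A z) = X at h ⊢
    rw [← h]
    abel
  have key := hbound V A _ (cnorm k V A) hV hcA hcB hAB hA
    fun i hi x hx => norm_iteratedFDerivWithin_le_cnorm hM hi hx
  refine Real.iSup_le (fun i => Real.iSup_le (fun x => ?_) (by positivity)) (by positivity)
  refine (key i (by omega) x x.2).trans ?_
  gcongr
  · linarith
  · omega

/-- quantitative inversion `I + A ↦ (I + A)⁻¹`, with the tame estimate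
`|(I+A)⁻¹ − I|_{V,k} ≤ C·(1+|A|_{V,k})^k·|A|_{V,k}`.  Matrices in `M_N(ℂ)` with the operator
norm are modelled as continuous linear endomorphisms of `ℂ^N`. -/
theorem versal_stmt_10 (d N k : ℕ) :
    ∃ C : ℝ, 0 < C ∧
      ∀ V : Set (EuclideanSpace ℝ (Fin d)), IsOpen V →
        ∀ A : EuclideanSpace ℝ (Fin d) →
            (EuclideanSpace ℂ (Fin N) →L[ℂ] EuclideanSpace ℂ (Fin N)),
          ContDiffOn ℝ k A V →
          (∀ z ∈ V, ‖A z‖ ≤ 1 / 2) →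
          (∃ M : ℝ, ∀ i ≤ k, ∀ x ∈ V, ‖iteratedFDerivWithin ℝ i A V x‖ ≤ M) →
          (∀ z ∈ V, IsUnit (1 + A z)) ∧
            ContDiffOn ℝ k (fun z => Ring.inverse (1 + A z) - 1) V ∧
            cnorm k V (fun z => Ring.inverse (1 + A z) - 1) ≤
              C * (1 + cnorm k V A) ^ k * cnorm k V A :=
  exists_cnorm_ringInverse_one_add_sub_one_le (EuclideanSpace ℝ (Fin d))
    (EuclideanSpace ℂ (Fin N) →L[ℂ] EuclideanSpace ℂ (Fin N)) k
end

section
/- Let K ⊂ ℝ^N be compact, let 𝒰 ⊇ K be open, and let ρ₁,…,ρ_m, τ₁,…,τ_s ∈ C¹(𝒰; ℝ) with m ≥ 1, s ≥ 0 and m + s ≤ N; set ρ(ζ) = (∑_{k=1}^m ρ_k(ζ)²)^{1/2}. Suppose that at every point ζ ∈ K with τ₁(ζ) = ⋯ = τ_s(ζ) = 0 and ρ(ζ) = 0 the gradients ∇ρ₁(ζ),…,∇ρ_m(ζ), ∇τ₁(ζ),…,∇τ_s(ζ) are linearly independent. Then there exist constants C > 0 and ε₀ > 0 such that for every ε with 0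 < ε < ε₀: ℋ^{N−s}( { ζ ∈ K : τ₁(ζ) = ⋯ = τ_s(ζ) = 0 and ρ(ζ) ≤ ε } ) ≤ C·ε^m. -/
open MeasureTheory Filter Topology Module
open scoped NNReal ENNReal

/-- A set on which `f` expands distances by a factor at least `1 / K` has Hausdorff measure
controlled by the volume of its image. -/
theorem hausdorffMeasure_le_mul_volume_image {X ι : Type*} [MetricSpace X] [MeasurableSpace X]
    [BorelSpace X] [Fintype ι] {f : X → ι → ℝ} {S : Set X} {K : ℝ≥0}
    (hf : ∀ x ∈ S, ∀ y ∈ S, dist x y ≤ K * dist (f x) (f y)) :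
    μH[Fintype.card ι] S ≤ (K : ℝ≥0∞) ^ Fintype.card ι * volume (f '' S) := by
  have hanti : AntilipschitzWith K (fun x : S => f x) :=
    AntilipschitzWith.of_le_mul_dist fun x y => hf x x.2 y y.2
  have h := hanti.le_hausdorffMeasure_image (Nat.cast_nonneg (Fintype.card ι)) Set.univ
  rw [hausdorffMeasure_pi_real, ENNReal.rpow_natCast, Set.image_univ] at h
  rw [← isometry_subtype_coe.hausdorffMeasure_image (Or.inl (Nat.cast_nonneg _)),
    Set.image_univ, Subtype.range_coe] at h
  rwa [Set.image_eq_range]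

/-- A map whose strict derivative at a point is injective expands distances near this point up to
a constant factor. -/
theorem HasStrictFDerivAt.exists_nhds_dist_le_mul {E F : Type*} [NormedAddCommGroup E]
    [NormedSpace ℝ E] [FiniteDimensional ℝ E] [NormedAddCommGroup F] [NormedSpace ℝ F]
    {f : E → F} {f' : E →L[ℝ] F} {x : E} (hf : HasStrictFDerivAt f f' x)
    (hinj : Function.Injective f') :
    ∃ V ∈ 𝓝 x, ∃ K : ℝ≥0, 0 < K ∧ ∀ y ∈ V, ∀ z ∈ V, dist y z ≤ K * dist (f y) (f z) := by
  obtain ⟨K, hK, hanti⟩ := f'.toLinearMap.injective_iff_antilipschitz.1 hinj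
  have hc : 0 < (2 * K)⁻¹ := by positivity
  obtain ⟨V, hV, happrox⟩ := hf.approximates_deriv_on_nhds (c := (2 * K)⁻¹) (Or.inr hc)
  refine ⟨V, hV, 2 * K, by positivity, fun y hy z hz => ?_⟩
  have h₁ := happrox y hy z hz
  have h₂ := hanti.le_mul_dist y z
  have h₃ : dist (f' y) (f' z) ≤ dist (f y) (f z) + ‖f y - f z - f' (y - z)‖ := by
    rw [dist_eq_norm, dist_eq_norm, ← map_sub]
    have := norm_sub_le (f y - f z) (f y - f z - f' (y - z))
    rwa [sub_sub_cancel] at this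
  rw [← dist_eq_norm y z] at h₁
  have hK' : (0 : ℝ) < K := hK
  calc dist y z = 2 * dist y z - dist y z := by ring
    _ ≤ 2 * (K * (dist (f y) (f z) + (2 * K : ℝ)⁻¹ * dist y z)) - dist y z := by
      gcongr
      refine h₂.trans (mul_le_mul_of_nonneg_left (h₃.trans ?_) hK'.le)
      gcongr
      simpa using h₁
    _ = _ := by
      push_cast
      field_simp
      ring

/-- Linearly independent functionals can be completed by linear functionals to an injective map
into a space of the same dimension. -/
theorem exists_injective_pi_sumElim {E ι : Type*} [NormedAddCommGroup E] [NormedSpace ℝ E]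
    [FiniteDimensional ℝ E] [Fintype ι] {φ : ι → E →L[ℝ] ℝ} (hφ : LinearIndependent ℝ φ) :
    ∃ n : ℕ, Fintype.card ι + n = finrank ℝ E ∧ ∃ ψ : Fin n → E →L[ℝ] ℝ,
      Function.Injective (ContinuousLinearMap.pi (Sum.elim φ ψ)) := by
  have hφ' : LinearIndependent ℝ fun i => (φ i : Dual ℝ E) :=
    hφ.map' (ContinuousLinearMap.coeLM ℝ) <|
      LinearMap.ker_eq_bot.2 ContinuousLinearMap.coe_injective
  set W := Submodule.span ℝ (Set.range fun i => (φ i : Dual ℝ E)) with hW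
  have hdim := Subspace.finrank_add_finrank_dualCoannihilator_eq W
  rw [hW, finrank_span_eq_card hφ', ← hW] at hdim
  obtain ⟨P, hP⟩ := W.dualCoannihilator.subtype.exists_leftInverse_of_injective
    (Submodule.ker_subtype _)
  let b := finBasis ℝ W.dualCoannihilator
  refine ⟨_, hdim, fun i => LinearMap.toContinuousLinearMap (b.coord i ∘ₗ P), ?_⟩
  rw [injective_iff_map_eq_zero]
  intro v hv
  have hvW : v ∈ W.dualCoannihilator := by
    rw [Submodule.mem_dualCoannihilator]
    intro f hf
    induction hf using Submodule.span_induction with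
    | mem f hf =>
      obtain ⟨i, rfl⟩ := hf
      exact congr_fun hv (Sum.inl i)
    | zero => rfl
    | add f g _ _ hf hg => simp [hf, hg]
    | smul a f _ hf => simp [hf]
  have hPv : P v = ⟨v, hvW⟩ := LinearMap.congr_fun hP ⟨v, hvW⟩
  have hzero : P v = 0 := b.ext_elem fun i => by
    simpa using congr_fun hv (Sum.inr i)
  exact congr_arg Subtype.val (hPv.symm.trans hzero)

/-- Near a point where the differentials of the functions `ρ k` and `τ j` are linearly independent,
the part of `{τ = 0}` where all `|ρ k|` are at most `ε` has measure `O(ε ^ m)`, where `m` is the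
number of functions `ρ k`. -/
theorem exists_nhds_hausdorffMeasure_le {E κ σ : Type*} [NormedAddCommGroup E] [NormedSpace ℝ E]
    [FiniteDimensional ℝ E] [MeasurableSpace E] [BorelSpace E] [Fintype κ] [Fintype σ]
    {ρ : κ → E → ℝ} {τ : σ → E → ℝ} {ρ' : κ → E →L[ℝ] ℝ} {τ' : σ → E →L[ℝ] ℝ} {x : E}
    (hρ : ∀ k, HasStrictFDerivAt (ρ k) (ρ' k) x) (hτ : ∀ j, HasStrictFDerivAt (τ j) (τ' j) x)
    (hind : LinearIndependent ℝ (Sum.elim ρ' τ')) :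
    ∃ V ∈ 𝓝 x, ∃ C : ℝ, 0 < C ∧ ∀ ε : ℝ, 0 < ε →
      μH[(finrank ℝ E - Fintype.card σ : ℕ)]
        {y | y ∈ V ∧ (∀ j, τ j y = 0) ∧ ∀ k, |ρ k y| ≤ ε} ≤
        ENNReal.ofReal (C * ε ^ Fintype.card κ) := by
  obtain ⟨n, hn, ψ, hψ⟩ := exists_injective_pi_sumElim hind
  have hstrict : HasStrictFDerivAt
      (fun y i => Sum.elim (Sum.elim ρ τ) (fun i => ⇑(ψ i)) i y)
      (ContinuousLinearMap.pi (Sum.elim (Sum.elim ρ' τ') ψ)) x := by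
    rw [hasStrictFDerivAt_pi]
    rintro ((k | j) | i)
    · exact hρ k
    · exact hτ j
    · exact (ψ i).hasStrictFDerivAt
  obtain ⟨V, hV, K, hK, hdist⟩ := hstrict.exists_nhds_dist_le_mul hψ
  obtain ⟨R, hR, hbound⟩ : ∃ R : ℝ, 0 < R ∧ ∀ y ∈ Metric.ball x 1, ∀ i, |ψ i y| ≤ R := by
    refine ⟨‖ContinuousLinearMap.pi ψ‖ * (1 + ‖x‖) + 1, by positivity, fun y hy i => ?_⟩
    have hy' : ‖y‖ ≤ 1 + ‖x‖ := by
      have h₁ := norm_le_norm_sub_add y x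
      have h₂ := mem_ball_iff_norm.1 hy
      linarith
    calc |ψ i y| ≤ ‖ContinuousLinearMap.pi ψ y‖ :=
          norm_le_pi_norm (ContinuousLinearMap.pi ψ y) i
      _ ≤ ‖ContinuousLinearMap.pi ψ‖ * ‖y‖ := ContinuousLinearMap.le_opNorm _ _
      _ ≤ ‖ContinuousLinearMap.pi ψ‖ * (1 + ‖x‖) := by gcongr
      _ ≤ _ := by linarith
  have hcard : finrank ℝ E - Fintype.card σ = Fintype.card (κ ⊕ Fin n) := by
    simp only [Fintype.card_sum, Fintype.card_fin] at hn ⊢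
    lia
  refine ⟨V ∩ Metric.ball x 1, inter_mem hV (Metric.ball_mem_nhds x one_pos),
    K ^ Fintype.card (κ ⊕ Fin n) * (2 ^ Fintype.card κ * (2 * R) ^ n), by positivity,
    fun ε hε => ?_⟩
  set S := {y | y ∈ V ∩ Metric.ball x 1 ∧ (∀ j, τ j y = 0) ∧ ∀ k, |ρ k y| ≤ ε}
  let f : E → κ ⊕ Fin n → ℝ := fun y i => Sum.elim ρ (fun i => ⇑(ψ i)) i y
  have hS : ∀ y ∈ S, ∀ z ∈ S, dist y z ≤ K * dist (f y) (f z) := by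
    intro y hy z hz
    refine (hdist y hy.1.1 z hz.1.1).trans (mul_le_mul_of_nonneg_left ?_ K.2)
    rw [dist_pi_le_iff dist_nonneg]
    rintro ((k | j) | i)
    · exact dist_le_pi_dist (f y) (f z) (Sum.inl k)
    · simp [hy.2.1 j, hz.2.1 j]
    · exact dist_le_pi_dist (f y) (f z) (Sum.inr i)
  have hbox : f '' S ⊆ Set.Icc (Sum.elim (fun _ => -ε) (fun _ => -R))
      (Sum.elim (fun _ => ε) (fun _ => R)) := by
    rintro _ ⟨y, hy, rfl⟩
    constructor
    · rintro (k | i)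
      · exact (abs_le.1 (hy.2.2 k)).1
      · exact (abs_le.1 (hbound y hy.1.2 i)).1
    · rintro (k | i)
      · exact (abs_le.1 (hy.2.2 k)).2
      · exact (abs_le.1 (hbound y hy.1.2 i)).2
  rw [hcard]
  refine (hausdorffMeasure_le_mul_volume_image hS).trans
    ((mul_le_mul_right (measure_mono hbox) _).trans_eq ?_)
  rw [Real.volume_Icc_pi, Fintype.prod_sum_type]
  simp only [Sum.elim_inl, Sum.elim_inr, sub_neg_eq_add, ← two_mul, Finset.prod_const,
    Finset.card_univ, Fintype.card_fin]
  rw [← ENNReal.ofReal_pow (by positivity), ← ENNReal.ofReal_pow (by positivity),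
    ← ENNReal.ofReal_mul (by positivity), ← ENNReal.ofReal_coe_nnreal,
    ← ENNReal.ofReal_pow (by positivity), ← ENNReal.ofReal_mul (by positivity)]
  congr 1
  ring



/-- measure estimate `ℋ^{N−s}({ζ ∈ K : τ = 0, ρ(ζ) ≤ ε}) ≤ C·ε^m` for the
strata of the tubular neighborhood `{ρ < ε}`, under the nondegeneracy (linear independence)
condition on the gradients of the defining functions. -/
theorem versal_stmt_11 (N m s : ℕ) (hm : 1 ≤ m) (hms : m + s ≤ N)
    (K : Set (EuclideanSpace ℝ (Fin N))) (hK : IsCompact K)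
    (U : Set (EuclideanSpace ℝ (Fin N))) (hU : IsOpen U) (hKU : K ⊆ U)
    (ρ : Fin m → EuclideanSpace ℝ (Fin N) → ℝ)
    (τ : Fin s → EuclideanSpace ℝ (Fin N) → ℝ)
    (hρ : ∀ k, ContDiffOn ℝ 1 (ρ k) U)
    (hτ : ∀ j, ContDiffOn ℝ 1 (τ j) U)
    (hind : ∀ ζ ∈ K, (∀ j, τ j ζ = 0) → Real.sqrt (∑ k, ρ k ζ ^ 2) = 0 →
      LinearIndependent ℝ
        (Sum.elim (fun k : Fin m => fderiv ℝ (ρ k) ζ)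
          (fun j : Fin s => fderiv ℝ (τ j) ζ))) :
    ∃ C : ℝ, 0 < C ∧ ∃ ε₀ : ℝ, 0 < ε₀ ∧
      ∀ ε : ℝ, 0 < ε → ε < ε₀ →
        μH[(N - s : ℕ)]
            {ζ | ζ ∈ K ∧ (∀ j, τ j ζ = 0) ∧ Real.sqrt (∑ k, ρ k ζ ^ 2) ≤ ε} ≤
          ENNReal.ofReal (C * ε ^ m) := by
  have hcontDiffAt : ∀ {f : EuclideanSpace ℝ (Fin N) → ℝ}, ContDiffOn ℝ 1 f U →
      ∀ ζ ∈ K, ContDiffAt ℝ 1 f ζ := fun hf ζ hζ => hf.contDiffAt (hU.mem_nhds (hKU hζ))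
  have habs : ∀ {ζ : EuclideanSpace ℝ (Fin N)} {ε : ℝ}, Real.sqrt (∑ k, ρ k ζ ^ 2) ≤ ε →
      ∀ k, |ρ k ζ| ≤ ε := fun h k => (Real.abs_le_sqrt <|
    Finset.single_le_sum (fun i _ => sq_nonneg (ρ i _)) (Finset.mem_univ k)).trans h
  let P : Set (EuclideanSpace ℝ (Fin N)) → Prop := fun A =>
    ∃ C : ℝ, 0 < C ∧ ∃ ε₀ : ℝ, 0 < ε₀ ∧ ∀ ε : ℝ, 0 < ε → ε < ε₀ →
      μH[(N - s : ℕ)] {ζ | ζ ∈ A ∧ (∀ j, τ j ζ = 0) ∧ Real.sqrt (∑ k, ρ k ζ ^ 2) ≤ ε} ≤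
        ENNReal.ofReal (C * ε ^ m)
  have hempty : ∀ (A : Set (EuclideanSpace ℝ (Fin N))) (ε₀ : ℝ), 0 < ε₀ →
      (∀ ζ ∈ A, (∀ j, τ j ζ = 0) → ε₀ ≤ Real.sqrt (∑ k, ρ k ζ ^ 2)) → P A := by
    intro A ε₀ hε₀ hA
    refine ⟨1, one_pos, ε₀, hε₀, fun ε _ hε => ?_⟩
    have : {ζ | ζ ∈ A ∧ (∀ j, τ j ζ = 0) ∧ Real.sqrt (∑ k, ρ k ζ ^ 2) ≤ ε} = ∅ :=
      Set.eq_empty_of_forall_notMem fun ζ hζ => (hε.trans_le (hA ζ hζ.1 hζ.2.1)).not_ge hζ.2.2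
    simp [this]
  refine hK.induction_on (p := P) (hempty ∅ 1 one_pos (by simp)) ?_ ?_ fun ζ hζ => ?_
  · rintro A B hAB ⟨C, hC, ε₀, hε₀, h⟩
    refine ⟨C, hC, ε₀, hε₀, fun ε hε hε' => (measure_mono ?_).trans (h ε hε hε')⟩
    exact fun ζ hζ => ⟨hAB hζ.1, hζ.2⟩
  · rintro A B ⟨C, hC, ε₁, hε₁, h₁⟩ ⟨D, hD, ε₂, hε₂, h₂⟩
    refine ⟨C + D, by positivity, min ε₁ ε₂, lt_min hε₁ hε₂, fun ε hε hε' => ?_⟩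
    rw [add_mul, ENNReal.ofReal_add (by positivity) (by positivity)]
    refine (measure_mono ?_).trans ((measure_union_le _ _).trans (add_le_add
      (h₁ ε hε (hε'.trans_le (min_le_left _ _))) (h₂ ε hε (hε'.trans_le (min_le_right _ _)))))
    rintro ξ ⟨hξ | hξ, hξ'⟩
    · exact Or.inl ⟨hξ, hξ'⟩
    · exact Or.inr ⟨hξ, hξ'⟩
  · by_cases hτζ : ∀ j, τ j ζ = 0
    · by_cases hρζ : Real.sqrt (∑ k, ρ k ζ ^ 2) = 0
      · obtain ⟨V, hV, C, hC, h⟩ := exists_nhds_hausdorffMeasure_le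
          (fun k => (hcontDiffAt (hρ k) ζ hζ).hasStrictFDerivAt one_ne_zero)
          (fun j => (hcontDiffAt (hτ j) ζ hζ).hasStrictFDerivAt one_ne_zero) (hind ζ hζ hτζ hρζ)
        simp only [finrank_euclideanSpace, Fintype.card_fin] at h
        refine ⟨V, mem_nhdsWithin_of_mem_nhds hV, C, hC, 1, one_pos, fun ε hε _ =>
          (measure_mono ?_).trans (h ε hε)⟩
        exact fun ξ hξ => ⟨hξ.1, hξ.2.1, habs hξ.2.2⟩
      · have hpos := (Real.sqrt_nonneg (∑ k, ρ k ζ ^ 2)).lt_of_ne' hρζ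
        have hcont : ContinuousAt (fun ξ => Real.sqrt (∑ k, ρ k ξ ^ 2)) ζ :=
          (tendsto_finsetSum _ fun k _ => (hcontDiffAt (hρ k) ζ hζ).continuousAt.pow 2).sqrt
        exact ⟨_, mem_nhdsWithin_of_mem_nhds (hcont.eventually_const_lt (half_lt_self hpos)),
          hempty _ _ (half_pos hpos) fun ξ hξ _ => le_of_lt hξ⟩
    · obtain ⟨j, hj⟩ := not_forall.1 hτζ
      exact ⟨_, mem_nhdsWithin_of_mem_nhds
        ((hcontDiffAt (hτ j) ζ hζ).continuousAt.eventually_ne hj),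
        hempty _ 1 one_pos fun ξ hξ hξ' => (hξ (hξ' j)).elim⟩
end
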